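/- Let κ be a singular cardinal of countable cofinality and let F be a family of subsets of κ with |F| < κ^{ℵ₀}. Then there exists a countably infinite subset b of κ that is cofinal in κ and has the property that no infinite member of F is a subset of b; in particular, every infinite member of F meets κ \ b. -/

import Mathlib

open Cardinal Set

/-- In an infinite linear order of size `#α` all of whose proper initial segments are smaller, any
function from a type of size at most `#α` is dominated by an injective one. -/
theorem exists_injective_ge {α X : Type*} [LinearOrder α] [Infinite α]
    (hα : ∀ a : α, #(Iio a) < #α) (g : X ↪ α) (c : X → α) :
    ∃ e : X → α, Function.Injective e ∧ ∀ x, c x ≤ e x := by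
  obtain ⟨p⟩ : Nonempty (α × α ≃ α) := Cardinal.eq.1 (by simp)
  have H (x : X) : ∃ y, c x ≤ p (g x, y) := by
    by_contra! h
    have hinj : Function.Injective fun y ↦ (⟨p (g x, y), h y⟩ : Iio (c x)) := by
      intro y z hyz
      simpa using p.injective (Subtype.ext_iff.1 hyz)
    exact (hα (c x)).not_ge (mk_le_of_injective hinj)
  choose y hy using H
  refine ⟨fun x ↦ p (g x, y x), fun x x' h ↦ ?_, hy⟩
  exact g.injective (Prod.ext_iff.1 (p.injective h)).1

theorem exists_seq_of_cof_eq_aleph0 {α : Type*} [LinearOrder α] (h : Order.cof α = ℵ₀) :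
    ∃ c : ℕ → α, ∀ a, ∃ n, a ≤ c n := by
  obtain ⟨s, hs, hcard⟩ := Order.exists_cof_eq α
  rw [h] at hcard
  obtain ⟨_⟩ := denumerable_iff.2 hcard
  refine ⟨fun n ↦ Denumerable.ofNat s n, fun a ↦ ?_⟩
  obtain ⟨b, hb, hab⟩ := hs a
  exact ⟨Encodable.encode (⟨b, hb⟩ : s), by simpa using hab⟩

/-- Two branches of the tree of finite sequences sharing infinitely many nodes are equal. -/
theorem eq_of_infinite_subset_range_prefix {α : Type*} {f g : ℕ → α} {A : Set (List α)}
    (hA : A.Infinite) (hf : A ⊆ range fun n ↦ (List.range n).map f)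
    (hg : A ⊆ range fun n ↦ (List.range n).map g) : f = g := by
  funext k
  obtain ⟨l, hl, hlk⟩ := hA.exists_notMem_finite
    ((finite_Iic k).image fun n ↦ (List.range n).map f)
  obtain ⟨n, rfl⟩ := hf hl
  obtain ⟨m, hm⟩ := hg hl
  have hmn : m = n := by simpa using congrArg List.length hm
  subst hmn
  have hk : k < m := by
    by_contra! h
    exact hlk (mem_image_of_mem _ h)
  exact (List.map_inj_left.1 hm k (List.mem_range.2 hk)).symm

/-- A linear order of countable cofinality all of whose proper initial segments are smaller carries
`#α ^ ℵ₀` countable cofinal sets with finite pairwise intersections. -/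
theorem exists_almostDisjoint_cofinal {α : Type*} [LinearOrder α] [Infinite α]
    (hα : ∀ a : α, #(Iio a) < #α) (hcof : Order.cof α = ℵ₀) :
    ∃ b : (ℕ → α) → Set α, (∀ f, (b f).Countable ∧ (b f).Infinite ∧ IsCofinal (b f)) ∧
      ∀ f g, (b f ∩ b g).Infinite → f = g := by
  obtain ⟨c, hc⟩ := exists_seq_of_cof_eq_aleph0 hcof
  obtain ⟨g₀⟩ : Nonempty (List α ↪ α) := (mk_list_eq_mk α).le
  obtain ⟨e, he, hce⟩ := exists_injective_ge hα g₀ fun l ↦ c l.length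
  have hpre (f : ℕ → α) : Function.Injective fun n ↦ (List.range n).map f :=
    fun m n h ↦ by simpa using congrArg List.length h
  refine ⟨fun f ↦ e '' range fun n ↦ (List.range n).map f, fun f ↦ ⟨?_, ?_, ?_⟩, ?_⟩
  · exact (countable_range _).image e
  · exact (infinite_range_of_injective (hpre f)).image he.injOn
  · intro a
    obtain ⟨n, hn⟩ := hc a
    refine ⟨_, mem_image_of_mem e (mem_range_self n), hn.trans ?_⟩
    simpa using hce ((List.range n).map f)
  · intro f g h
    rw [← image_inter he] at h
    exact eq_of_infinite_subset_range_prefix h.of_image inter_subset_left inter_subset_right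

theorem stmt4 (κ : Cardinal.{0}) (h1 : ℵ₀ ≤ κ) (h2 : ¬ κ.IsRegular)
    (h3 : κ.ord.cof = ℵ₀)
    (ι : Type) (F : ι → Set Ordinal.{0}) (hF : #ι < κ ^ ℵ₀)
    (hsub : ∀ i, F i ⊆ Set.Iio κ.ord) :
    ∃ b : Set Ordinal.{0}, b.Countable ∧ b.Infinite ∧ b ⊆ Set.Iio κ.ord ∧
      sSup b = κ.ord ∧
      (∀ i, (F i).Infinite → ¬ F i ⊆ b) ∧
      (∀ i, (F i).Infinite → (F i ∩ (Set.Iio κ.ord \ b)).Nonempty) := by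
  have hmk : #κ.ord.ToType = κ := by simp
  have : Infinite κ.ord.ToType := by rwa [infinite_iff, hmk]
  obtain ⟨b, hb, hbb⟩ := exists_almostDisjoint_cofinal (α := κ.ord.ToType)
    (fun a ↦ mk_Iio_lt a (by simp)) (by rwa [Ordinal.cof_toType])
  let v : κ.ord.ToType → Ordinal := fun a ↦ Ordinal.ToType.toOrd a
  have hv : Function.Injective v :=
    Subtype.val_injective.comp Ordinal.ToType.mk.symm.injective
  have hvlt (a) : v a < κ.ord := (Ordinal.ToType.toOrd a).2
  obtain ⟨f, hf⟩ : ∃ f, ∀ i, (F i).Infinite → ¬ F i ⊆ v '' b f := by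
    by_contra! h
    choose i hi hib using h
    have hinj : Function.Injective i := by
      intro f g hfg
      refine hbb f g (Infinite.of_image v ?_)
      rw [image_inter hv]
      exact (hi f).mono (subset_inter (hib f) (hfg ▸ hib g))
    refine hF.not_ge ?_
    simpa using mk_le_of_injective hinj
  obtain ⟨hcount, hinf, hcofinal⟩ := hb f
  have hsub' : v '' b f ⊆ Iio κ.ord := image_subset_iff.2 fun a _ ↦ hvlt a
  refine ⟨v '' b f, hcount.image v, hinf.image hv.injOn, hsub', ?_, hf, fun i hi ↦ ?_⟩
  · refine IsLUB.csSup_eq ⟨fun a ha ↦ (hsub' ha).le, fun u hu ↦ ?_⟩ (hinf.nonempty.image v)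
    by_contra! hlt
    have hlim := isSuccLimit_ord h1
    obtain ⟨a, ha, hle⟩ := hcofinal (Ordinal.ToType.mk ⟨Order.succ u, hlim.succ_lt hlt⟩)
    have hle' : Order.succ u ≤ v a := (OrderIso.le_symm_apply _).2 hle
    exact (Order.succ_le_iff.1 hle').not_ge (hu (mem_image_of_mem v ha))
  · obtain ⟨x, hx, hxb⟩ := not_subset.1 (hf i hi)
    exact ⟨x, hx, hsub i hx, hxb⟩
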